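/- The ℓ-primary component of the torsion subgroup of the quotient ℤ[Γ]/S̃ is trivial if m is even, and is cyclic of order ℓ^r if m is odd. -/

import Mathlib

set_option maxHeartbeats 1000000

/-- The norm element `s(H) = Σ_{h ∈ H} h` of a subgroup `H`, in the integral group ring. -/
noncomputable def sElt {Γ : Type} [Group Γ] [Finite Γ] (H : Subgroup Γ) :
    MonoidAlgebra ℤ Γ :=
  letI : Fintype H := Fintype.ofFinite _
  ∑ h : H, MonoidAlgebra.of ℤ Γ (h : Γ)

section NormElement

variable {Γ : Type} [CommGroup Γ] [Finite Γ]

lemma sElt_eq_sum (H : Subgroup Γ) [Fintype H] :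
    sElt H = ∑ h : H, MonoidAlgebra.of ℤ Γ (h : Γ) := by
  unfold sElt
  congr!

lemma of_mul_sElt (H : Subgroup Γ) {h : Γ} (hh : h ∈ H) :
    MonoidAlgebra.of ℤ Γ h * sElt H = sElt H := by
  have := Fintype.ofFinite H
  rw [sElt_eq_sum, Finset.mul_sum]
  simp_rw [← map_mul]
  exact Fintype.sum_equiv (Equiv.mulLeft (⟨h, hh⟩ : H)) _ _ fun x => by simp

lemma sub_one_mul_sElt (H : Subgroup Γ) {h : Γ} (hh : h ∈ H) :
    (MonoidAlgebra.of ℤ Γ h - 1) * sElt H = 0 := by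
  rw [sub_mul, one_mul, of_mul_sElt H hh, sub_self]

lemma sElt_mul_self (H : Subgroup Γ) :
    sElt H * sElt H = (Nat.card H : MonoidAlgebra ℤ Γ) * sElt H := by
  have := Fintype.ofFinite H
  nth_rewrite 1 [sElt_eq_sum]
  rw [Finset.sum_mul, Finset.sum_congr rfl fun h _ => of_mul_sElt H h.2]
  simp

lemma sElt_mul_of_disjoint {H K L : Subgroup Γ} (hd : Disjoint H K) (hL : H ⊔ K = L) :
    sElt L = sElt H * sElt K := by
  have := Fintype.ofFinite H
  have := Fintype.ofFinite K
  have := Fintype.ofFinite L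
  rw [sElt_eq_sum, sElt_eq_sum, sElt_eq_sum, Finset.sum_mul_sum, ← Finset.sum_product']
  symm
  refine Finset.sum_bij (fun p _ => (⟨p.1 * p.2, hL ▸ Subgroup.mul_mem_sup p.1.2 p.2.2⟩ : L))
    (by simp) ?_ ?_ (by simp)
  · intro p _ q _ h
    exact Subgroup.mul_injective_of_disjoint hd (congrArg Subtype.val h)
  · rintro ⟨x, hx⟩ _
    rw [← hL, Subgroup.mem_sup'] at hx
    obtain ⟨y, z, h⟩ := hx
    exact ⟨(y, z), by simp, by simp [h]⟩

lemma sElt_zpowers (x : Γ) :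
    sElt (Subgroup.zpowers x) =
      ∑ k ∈ Finset.range (orderOf x), MonoidAlgebra.of ℤ Γ x ^ k := by
  have := Fintype.ofFinite (Subgroup.zpowers x)
  rw [sElt_eq_sum, ← Fin.sum_univ_eq_sum_range fun k => MonoidAlgebra.of ℤ Γ x ^ k]
  symm
  exact Fintype.sum_equiv (finEquivZPowers (isOfFinOrder_of_finite x)) _ _ fun k => by
    rw [← map_pow, finEquivZPowers_apply]

end NormElement

section Stabilizer

variable {Γ : Type} [CommGroup Γ]

/-- The elements of `Γ` acting trivially on the quotient of the group ring by an ideal. -/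
def Ideal.trivialActing (𝔞 : Ideal (MonoidAlgebra ℤ Γ)) : Subgroup Γ where
  carrier := {h | MonoidAlgebra.of ℤ Γ h - 1 ∈ 𝔞}
  one_mem' := by rw [Set.mem_ofPred_eq, map_one, sub_self]; exact 𝔞.zero_mem
  mul_mem' {x y} hx hy := by
    have : MonoidAlgebra.of ℤ Γ (x * y) - 1 =
        MonoidAlgebra.of ℤ Γ x * (MonoidAlgebra.of ℤ Γ y - 1) + (MonoidAlgebra.of ℤ Γ x - 1) := by
      rw [map_mul]; ring
    simpa only [Set.mem_ofPred_eq, this] using 𝔞.add_mem (𝔞.mul_mem_left _ hy) hx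
  inv_mem' {x} hx := by
    have h1 : MonoidAlgebra.of ℤ Γ x⁻¹ * MonoidAlgebra.of ℤ Γ x = 1 := by
      rw [← map_mul, inv_mul_cancel, map_one]
    have : MonoidAlgebra.of ℤ Γ x⁻¹ - 1 =
        -(MonoidAlgebra.of ℤ Γ x⁻¹ * (MonoidAlgebra.of ℤ Γ x - 1)) := by
      rw [mul_sub, h1]; ring
    simpa only [Set.mem_ofPred_eq, this] using 𝔞.neg_mem (𝔞.mul_mem_left _ hx)

lemma Ideal.mem_trivialActing {𝔞 : Ideal (MonoidAlgebra ℤ Γ)} {h : Γ} :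
    h ∈ 𝔞.trivialActing ↔ MonoidAlgebra.of ℤ Γ h - 1 ∈ 𝔞 := Iff.rfl

lemma MonoidAlgebra.addHom_ext_of {A : Type*} [AddCommGroup A] {f g : MonoidAlgebra ℤ Γ →+ A}
    (h : ∀ x, f (MonoidAlgebra.of ℤ Γ x) = g (MonoidAlgebra.of ℤ Γ x)) : f = g := by
  refine MonoidAlgebra.addHom_ext' fun m => ?_
  ext
  exact h m

/-- The elements of the group ring supported on a subgroup. -/
noncomputable def supportedOn (K : Subgroup Γ) : Submodule ℤ (MonoidAlgebra ℤ Γ) :=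
  Submodule.span ℤ (MonoidAlgebra.of ℤ Γ '' K)

lemma of_mem_supportedOn {K : Subgroup Γ} {k : Γ} (hk : k ∈ K) :
    MonoidAlgebra.of ℤ Γ k ∈ supportedOn K :=
  Submodule.subset_span ⟨k, hk, rfl⟩

lemma sub_one_mem_supportedOn {K : Subgroup Γ} {k : Γ} (hk : k ∈ K) :
    MonoidAlgebra.of ℤ Γ k - 1 ∈ supportedOn K := by
  have := of_mem_supportedOn K.one_mem
  rw [map_one] at this
  exact sub_mem (of_mem_supportedOn hk) this

lemma image_sub_one_subset_supportedOn (N : Subgroup Γ) :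
    (fun ν => MonoidAlgebra.of ℤ Γ ν - 1) '' N ⊆ supportedOn N := by
  rintro _ ⟨ν, hν, rfl⟩
  exact sub_one_mem_supportedOn hν

lemma sElt_mem_supportedOn [Finite Γ] {H K : Subgroup Γ} (h : H ≤ K) :
    sElt H ∈ supportedOn K := by
  have := Fintype.ofFinite H
  rw [sElt_eq_sum]
  exact sum_mem fun x _ => of_mem_supportedOn (h x.2)

lemma supportedOn_mono {H K : Subgroup Γ} (h : H ≤ K) : supportedOn H ≤ supportedOn K :=
  Submodule.span_mono (Set.image_mono h)

/-- A group ring is relatively induced from `H` compatibly with any subgroup disjoint from `H`: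
truncation to a `K`-stable transversal of `H`. -/
lemma exists_truncation {H K : Subgroup Γ} [Fintype H] (hd : Disjoint H K) :
    ∃ π : MonoidAlgebra ℤ Γ →+ MonoidAlgebra ℤ Γ,
      (∀ k ∈ supportedOn K, ∀ f, π (k * f) = k * π f) ∧
      ∀ f, ∑ h : H, MonoidAlgebra.of ℤ Γ h * π (MonoidAlgebra.of ℤ Γ (h : Γ)⁻¹ * f) = f := by
  classical
  let rep : Γ → Γ := fun x => (QuotientGroup.mk x : Γ ⧸ (H ⊔ K)).out
  have hrep : ∀ x y, x⁻¹ * y ∈ H ⊔ K → rep x = rep y := fun x y h => by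
    have : (QuotientGroup.mk x : Γ ⧸ (H ⊔ K)) = QuotientGroup.mk y := QuotientGroup.eq.2 h
    simp only [rep, this]
  have hex : ∀ x, ∃ h ∈ H, ∃ k ∈ K, h * k = (rep x)⁻¹ * x := fun x => by
    rw [← Subgroup.mem_sup, ← QuotientGroup.eq]
    exact QuotientGroup.out_eq' _
  choose p hpH q hqK hpq using hex
  have huniq : ∀ x, ∀ h ∈ H, ∀ k ∈ K, h * k = (rep x)⁻¹ * x → p x = h := by
    intro x h hh k hk e
    have := @Subgroup.mul_injective_of_disjoint _ _ _ _ hd (⟨p x, hpH x⟩, ⟨q x, hqK x⟩)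
      (⟨h, hh⟩, ⟨k, hk⟩) ((hpq x).trans e.symm)
    simpa using congrArg (fun z => (z.1 : Γ)) this
  have hpH' : ∀ x, ∀ h ∈ H, p (h * x) = h * p x := fun x h hh => by
    refine huniq _ _ (mul_mem hh (hpH x)) _ (hqK x) ?_
    rw [hrep (h * x) x (by simpa using Subgroup.mem_sup_left hh), mul_assoc, hpq]
    exact mul_left_comm _ _ _
  have hpK' : ∀ x, ∀ k ∈ K, p (k * x) = p x := fun x k hk => by
    refine huniq _ _ (hpH x) _ (mul_mem hk (hqK x)) ?_
    rw [hrep (k * x) x (by simpa using Subgroup.mem_sup_right hk), mul_left_comm, hpq]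
    exact mul_left_comm _ _ _
  let π : MonoidAlgebra ℤ Γ →+ MonoidAlgebra ℤ Γ :=
    (Finsupp.liftAddHom fun x => if p x = 1 then MonoidAlgebra.singleAddHom x else 0).comp
      MonoidAlgebra.coeffAddEquiv.toAddMonoidHom
  have hπ : ∀ x, π (MonoidAlgebra.of ℤ Γ x) = if p x = 1 then MonoidAlgebra.of ℤ Γ x else 0 := by
    intro x
    simp only [π, MonoidAlgebra.of_apply]
    split_ifs with h <;> simp [h]
  refine ⟨π, fun k hk => ?_, fun f => ?_⟩
  · induction hk using Submodule.span_induction with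
    | mem k hk =>
      obtain ⟨k, hk, rfl⟩ := hk
      refine fun f => DFunLike.congr_fun (f := π.comp (AddMonoidHom.mulLeft _))
        (g := (AddMonoidHom.mulLeft _).comp π) (MonoidAlgebra.addHom_ext_of fun x => ?_) f
      simp only [AddMonoidHom.comp_apply, AddMonoidHom.coe_mulLeft, ← map_mul, hπ,
        hpK' x k hk, mul_ite, mul_zero]
    | zero => simp
    | add x y _ _ hx hy => simp [add_mul, hx, hy]
    | smul a x _ hx => intro f; rw [smul_mul_assoc, map_zsmul, hx, smul_mul_assoc]
  · refine DFunLike.congr_fun (f := ∑ h : H, (AddMonoidHom.mulLeft (MonoidAlgebra.of ℤ Γ h)).comp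
      (π.comp (AddMonoidHom.mulLeft (MonoidAlgebra.of ℤ Γ (h : Γ)⁻¹)))) (g := AddMonoidHom.id _)
      (MonoidAlgebra.addHom_ext_of fun x => ?_) f |> fun e => by
        simpa [AddMonoidHom.finsetSum_apply] using e
    simp only [AddMonoidHom.finsetSum_apply, AddMonoidHom.comp_apply, AddMonoidHom.coe_mulLeft,
      ← map_mul, hπ, AddMonoidHom.id_apply]
    rw [Finset.sum_eq_single (⟨p x, hpH x⟩ : H)]
    · rw [if_pos (by rw [hpH' _ _ (inv_mem (hpH x))]; simp), ← map_mul, mul_inv_cancel_left]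
    · intro h _ hne
      rw [hpH' _ _ (inv_mem h.2), if_neg, mul_zero]
      intro e
      exact hne (Subtype.ext (inv_mul_eq_one.1 e))
    · simp

lemma map_mem_span_of_commutes {S : Set (MonoidAlgebra ℤ Γ)}
    {G : Set (MonoidAlgebra ℤ Γ)} (hG : G ⊆ S) {π : MonoidAlgebra ℤ Γ →+ MonoidAlgebra ℤ Γ}
    (hπ : ∀ k ∈ S, ∀ f, π (k * f) = k * π f) {x : MonoidAlgebra ℤ Γ} (hx : x ∈ Ideal.span G) :
    π x ∈ Ideal.span G := by
  suffices ∀ r, π (r * x) ∈ Ideal.span G by simpa using this 1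
  induction hx using Submodule.span_induction with
  | mem g hg =>
    intro r
    rw [mul_comm, hπ g (hG hg)]
    exact Ideal.mul_mem_right _ _ (Ideal.subset_span hg)
  | zero => simp
  | add x y _ _ hx hy =>
    intro r
    rw [mul_add, map_add]
    exact add_mem (hx r) (hy r)
  | smul a x _ hx =>
    intro r
    rw [smul_eq_mul, ← mul_assoc]
    exact hx _

/-- Vanishing of Tate cohomology in degree `0`: elements fixed by `H` modulo an ideal supported
away from `H` are norms. -/
lemma mem_sup_sElt_of_fixed [Finite Γ] {H K : Subgroup Γ} (hd : Disjoint H K)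
    {G : Set (MonoidAlgebra ℤ Γ)} (hG : G ⊆ supportedOn K) {f : MonoidAlgebra ℤ Γ}
    (hf : H ≤ ((Ideal.span G).colon {f}).trivialActing) :
    f ∈ Ideal.span G ⊔ Ideal.span {sElt H} := by
  have := Fintype.ofFinite H
  obtain ⟨π, hπK, hπ⟩ := exists_truncation hd
  have key : f - sElt H * π f ∈ Ideal.span G := by
    nth_rewrite 1 [← hπ f]
    rw [sElt_eq_sum, Finset.sum_mul, ← Finset.sum_sub_distrib]
    refine sum_mem fun h _ => ?_
    rw [← mul_sub, ← map_sub, ← sub_one_mul]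
    refine Ideal.mul_mem_left _ _ (map_mem_span_of_commutes hG hπK ?_)
    exact Submodule.mem_colon_singleton.1 (hf (inv_mem h.2))
  have := add_mem (Ideal.mem_sup_left key : _ ∈ Ideal.span G ⊔ Ideal.span {sElt H})
    (Ideal.mem_sup_right (Ideal.mul_mem_right (π f) _ (Ideal.mem_span_singleton_self (sElt H))))
  simpa using this

/-- Vanishing of Tate cohomology in degree `-1`: elements killed by the norm of `H` modulo an
ideal supported away from `H` lie in the ideal generated by the augmentation ideal of `H`. -/
lemma mem_of_sElt_mul_mem [Finite Γ] {H K : Subgroup Γ} (hd : Disjoint H K)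
    {G : Set (MonoidAlgebra ℤ Γ)} (hG : G ⊆ supportedOn K) {f : MonoidAlgebra ℤ Γ}
    (hf : sElt H * f ∈ Ideal.span G) {𝔟 : Ideal (MonoidAlgebra ℤ Γ)}
    (hG𝔟 : Ideal.span G ≤ 𝔟) (hH : H ≤ 𝔟.trivialActing) :
    f ∈ 𝔟 := by
  have := Fintype.ofFinite H
  obtain ⟨π, hπK, hπ⟩ := exists_truncation hd
  have h1 : ∑ h : H, π (MonoidAlgebra.of ℤ Γ (h : Γ)⁻¹ * f) ∈ 𝔟 := by
    have h2 := hG𝔟 (map_mem_span_of_commutes hG hπK hf)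
    rw [sElt_eq_sum, Finset.sum_mul, map_sum] at h2
    convert h2 using 1
    exact Fintype.sum_equiv (Equiv.inv H) _ _ fun x => by simp
  rw [← sub_add_cancel f (∑ h : H, π (MonoidAlgebra.of ℤ Γ (h : Γ)⁻¹ * f))]
  refine add_mem ?_ h1
  nth_rewrite 1 [← hπ f]
  rw [← Finset.sum_sub_distrib]
  refine sum_mem fun h _ => ?_
  rw [← sub_one_mul]
  exact Ideal.mul_mem_right _ _ (hH h.2)

end Stabilizer

section Quotients

variable {R A : Type*} [CommRing R] [AddCommGroup A]

/-- The quotient `C / (C ⊓ 𝔟)` of ideals is additively isomorphic to `A`. -/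
def HasQuotientIso (C 𝔟 : Ideal R) (A : Type*) [AddCommGroup A] : Prop :=
  ∃ φ : C →+ A, Function.Surjective φ ∧ ∀ x, φ x = 0 ↔ (x : R) ∈ 𝔟

lemma mem_sup_span_singleton_iff {𝔞 : Ideal R} {b x : R} :
    x ∈ 𝔞 ⊔ Ideal.span {b} ↔ ∃ c, x - b * c ∈ 𝔞 := by
  rw [sup_comm, Ideal.mem_span_singleton_sup]
  constructor
  · rintro ⟨c, y, hy, rfl⟩
    exact ⟨c, by rwa [show c * b + y - b * c = y by ring]⟩
  · rintro ⟨c, h⟩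
    exact ⟨c, _, h, by ring⟩

lemma exists_addHom_of_relation {C D 𝔞 : Ideal R} (ψ : D →+ A) (a u : R)
    (hex : ∀ x ∈ C, ∃ y ∈ D, a * x - u * y ∈ 𝔞)
    (hzero : ∀ y : D, u * y ∈ 𝔞 → ψ y = 0) :
    ∃ φ : C →+ A, ∀ (x : C) (y : D), a * x - u * y ∈ 𝔞 → φ x = ψ y := by
  choose f hfD hf using hex
  have key : ∀ (x : C) (y : D), a * x - u * y ∈ 𝔞 → ψ ⟨f x x.2, hfD x x.2⟩ = ψ y := by
    intro x y h
    rw [← sub_eq_zero, ← map_sub]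
    refine hzero _ ?_
    have := 𝔞.sub_mem h (hf x x.2)
    push_cast
    convert this using 1
    ring
  refine ⟨AddMonoidHom.mk' (fun x => ψ ⟨f x x.2, hfD x x.2⟩) fun x y => ?_, key⟩
  rw [← map_add]
  refine key _ _ ?_
  have := 𝔞.add_mem (hf x x.2) (hf y y.2)
  push_cast
  convert this using 1
  ring

/-- Dimension shifting for the Tate cohomology of a cyclic group, where `a = j - 1` and `b` is the
norm of `j`. -/
lemma HasQuotientIso.shift {𝔞 : Ideal R} {a b u v : R} (hab : a * b = 0) (huv : u * v = 0)
    (ha : ∀ x, a * x ∈ 𝔞 → x ∈ 𝔞 ⊔ Ideal.span {b})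
    (hb : ∀ x, b * x ∈ 𝔞 → x ∈ 𝔞 ⊔ Ideal.span {a})
    (hu : ∀ x, u * x ∈ 𝔞 → x ∈ 𝔞 ⊔ Ideal.span {v})
    (h : HasQuotientIso ((𝔞 ⊔ Ideal.span {v}).colon {b}) (𝔞 ⊔ Ideal.span {v} ⊔ Ideal.span {a}) A) :
    HasQuotientIso ((𝔞 ⊔ Ideal.span {u}).colon {a}) (𝔞 ⊔ Ideal.span {u} ⊔ Ideal.span {b}) A := by
  obtain ⟨ψ, hψs, hψ⟩ := h
  have hex : ∀ x ∈ (𝔞 ⊔ Ideal.span {u}).colon {a},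
      ∃ y ∈ (𝔞 ⊔ Ideal.span {v}).colon {b}, a * x - u * y ∈ 𝔞 := by
    intro x hx
    rw [Submodule.mem_colon_singleton, smul_eq_mul, mem_sup_span_singleton_iff] at hx
    obtain ⟨y, hy⟩ := hx
    rw [mul_comm x a] at hy
    refine ⟨y, ?_, hy⟩
    rw [Submodule.mem_colon_singleton]
    refine hu _ ?_
    rw [show u * (y • b) = -(b * (a * x - u * y)) by
      rw [smul_eq_mul]; linear_combination x * hab]
    exact neg_mem (Ideal.mul_mem_left _ _ hy)
  obtain ⟨φ, hφ⟩ := exists_addHom_of_relation ψ a u hex fun y hy =>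
    (hψ y).2 (Ideal.mem_sup_left (hu _ hy))
  refine ⟨φ, fun z => ?_, fun x => ⟨fun h => ?_, fun h => ?_⟩⟩
  · obtain ⟨y, rfl⟩ := hψs z
    obtain ⟨c, hc⟩ := mem_sup_span_singleton_iff.1 (Submodule.mem_colon_singleton.1 y.2)
    have h1 : b * (u * y) ∈ 𝔞 := by
      rw [smul_eq_mul] at hc
      rw [show b * (u * y) = u * (y * b - v * c) by linear_combination c * huv]
      exact Ideal.mul_mem_left _ _ hc
    obtain ⟨x, hx⟩ := mem_sup_span_singleton_iff.1 (hb _ h1)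
    have hx' : a * x - u * y ∈ 𝔞 := by simpa using neg_mem hx
    refine ⟨⟨x, ?_⟩, hφ _ _ hx'⟩
    rw [Submodule.mem_colon_singleton, mem_sup_span_singleton_iff]
    exact ⟨y, by rwa [smul_eq_mul, mul_comm]⟩
  · obtain ⟨y, hyD, hy⟩ := hex x x.2
    rw [hφ x ⟨y, hyD⟩ hy, hψ, mem_sup_span_singleton_iff] at h
    obtain ⟨z, hz⟩ := h
    obtain ⟨c, hc⟩ := mem_sup_span_singleton_iff.1 hz
    have h1 : a * (x - u * z) ∈ 𝔞 := by
      rw [show a * (x - u * z) = a * x - u * y + u * (y - a * z - v * c) by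
        linear_combination c * huv]
      exact add_mem hy (Ideal.mul_mem_left _ _ hc)
    obtain ⟨d, hd⟩ := mem_sup_span_singleton_iff.1 (ha _ h1)
    rw [mem_sup_span_singleton_iff]
    refine ⟨d, mem_sup_span_singleton_iff.2 ⟨z, ?_⟩⟩
    rwa [sub_right_comm]
  · obtain ⟨d, hd⟩ := mem_sup_span_singleton_iff.1 h
    obtain ⟨z, hz⟩ := mem_sup_span_singleton_iff.1 hd
    have hD : a * z ∈ (𝔞 ⊔ Ideal.span {v}).colon {b} := by
      rw [Submodule.mem_colon_singleton, smul_eq_mul, mul_right_comm, hab, zero_mul]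
      exact zero_mem _
    rw [hφ x ⟨_, hD⟩, hψ]
    · exact Ideal.mem_sup_right (Ideal.mul_mem_right _ _ (Ideal.mem_span_singleton_self a))
    · rw [show a * x - u * (a * z) = a * (x - b * d - u * z) by linear_combination d * hab]
      exact Ideal.mul_mem_left _ _ hz

lemma Ideal.mem_of_coprime_mul_mem {I : Ideal R} {ℓ n : ℕ} (h : ℓ.Coprime n) {x : R}
    (h1 : (ℓ : R) * x ∈ I) (h2 : (n : R) * x ∈ I) : x ∈ I := by
  obtain ⟨u, v, huv⟩ := Nat.Coprime.cast (R := R) h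
  rw [← one_mul x, ← huv, add_mul, mul_assoc, mul_assoc]
  exact add_mem (I.mul_mem_left _ h1) (I.mul_mem_left _ h2)

lemma Ideal.mem_of_pow_mul_mem {I : Ideal R} {ℓ : R} (hI : ∀ x, ℓ * x ∈ I → x ∈ I) (k : ℕ)
    {x : R} (h : ℓ ^ k * x ∈ I) : x ∈ I := by
  induction k with
  | zero => simpa using h
  | succ k ih => exact ih (hI _ (by rwa [← mul_assoc, ← pow_succ']))

end Quotients

section Saturation

variable {Γ : Type} [CommGroup Γ]

lemma span_union_image_insert {R ι : Type*} [CommRing R] [DecidableEq ι] (G : Set R)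
    (w : ι → R) (I : Finset ι) (k : ι) :
    Ideal.span (G ∪ w '' ↑(insert k I)) = Ideal.span (G ∪ w '' ↑I) ⊔ Ideal.span {w k} := by
  rw [← Ideal.span_union, Finset.coe_insert, Set.image_insert_eq, Set.union_assoc,
    Set.union_singleton]

lemma union_image_subset_supportedOn {ι : Type*} {G : Set (MonoidAlgebra ℤ Γ)} {K₀ : Subgroup Γ}
    (hG : G ⊆ supportedOn K₀) {w : ι → MonoidAlgebra ℤ Γ} {K : ι → Subgroup Γ} {I : Finset ι}
    (hw : ∀ i ∈ I, w i ∈ supportedOn (K i)) :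
    G ∪ w '' ↑I ⊆ supportedOn (K₀ ⊔ ⨆ i ∈ I, K i) := by
  refine Set.union_subset (hG.trans (supportedOn_mono le_sup_left)) ?_
  rintro _ ⟨i, hi, rfl⟩
  exact supportedOn_mono (le_sup_of_le_right (le_iSup₂_of_le i hi le_rfl)) (hw i hi)

variable [Finite Γ]

lemma saturated_sup_sElt_mul {ℓ : ℕ} {H K : Subgroup Γ} (hd : Disjoint H K)
    {G : Set (MonoidAlgebra ℤ Γ)} (hG : G ⊆ supportedOn K)
    (hsat : ∀ x, (ℓ : MonoidAlgebra ℤ Γ) * x ∈ Ideal.span G → x ∈ Ideal.span G)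
    {e : MonoidAlgebra ℤ Γ} {n : ℕ} (hn : ℓ.Coprime n) (he : e * e = n * e)
    {x : MonoidAlgebra ℤ Γ} (hx : (ℓ : MonoidAlgebra ℤ Γ) * x ∈
      Ideal.span G ⊔ Ideal.span {sElt H * e}) :
    x ∈ Ideal.span G ⊔ Ideal.span {sElt H * e} := by
  obtain ⟨c, hc⟩ := mem_sup_span_singleton_iff.1 hx
  have h1 : (n - e) * x ∈ Ideal.span G := by
    refine hsat _ ?_
    rw [show (ℓ : MonoidAlgebra ℤ Γ) * ((n - e) * x) = (n - e) * (ℓ * x - sElt H * e * c) by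
      linear_combination (-sElt H * c) * he]
    exact Ideal.mul_mem_left _ _ hc
  have h2 : x ∈ Ideal.span G ⊔ Ideal.span {sElt H} := by
    refine mem_sup_sElt_of_fixed hd hG fun h hh => ?_
    rw [Ideal.mem_trivialActing, Submodule.mem_colon_singleton, smul_eq_mul]
    refine hsat _ ?_
    rw [show (ℓ : MonoidAlgebra ℤ Γ) * ((MonoidAlgebra.of ℤ Γ h - 1) * x) =
        (MonoidAlgebra.of ℤ Γ h - 1) * (ℓ * x - sElt H * e * c) by
      linear_combination (e * c) * sub_one_mul_sElt H hh]
    exact Ideal.mul_mem_left _ _ hc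
  obtain ⟨d, hd⟩ := mem_sup_span_singleton_iff.1 h2
  refine Ideal.mem_of_coprime_mul_mem hn hx (mem_sup_span_singleton_iff.2 ⟨d, ?_⟩)
  rw [show n * x - sElt H * e * d = (n - e) * x + e * (x - sElt H * d) by ring]
  exact add_mem h1 (Ideal.mul_mem_left _ _ hd)

/-- An ideal generated by norms of independent subgroups is saturated at `ℓ`. -/
lemma saturated_span_norms {ι : Type*} [DecidableEq ι] {ℓ : ℕ} {G : Set (MonoidAlgebra ℤ Γ)}
    {K₀ : Subgroup Γ} (hG : G ⊆ supportedOn K₀)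
    (hsat : ∀ x, (ℓ : MonoidAlgebra ℤ Γ) * x ∈ Ideal.span G → x ∈ Ideal.span G)
    (H K : ι → Subgroup Γ) (w e : ι → MonoidAlgebra ℤ Γ) (n : ι → ℕ) (I : Finset ι)
    (hw : ∀ i ∈ I, w i = sElt (H i) * e i) (hn : ∀ i ∈ I, ℓ.Coprime (n i))
    (he : ∀ i ∈ I, e i * e i = n i * e i) (hwK : ∀ i ∈ I, w i ∈ supportedOn (K i))
    (hd : ∀ k ∈ I, Disjoint (H k) (K₀ ⊔ ⨆ i ∈ I.erase k, K i)) :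
    ∀ x, (ℓ : MonoidAlgebra ℤ Γ) * x ∈ Ideal.span (G ∪ w '' ↑I) →
      x ∈ Ideal.span (G ∪ w '' ↑I) := by
  induction I using Finset.induction_on with
  | empty => simpa using hsat
  | insert k I hk ih =>
    simp only [Finset.forall_mem_insert] at hw hn he hwK
    intro x
    rw [span_union_image_insert, hw.1]
    refine saturated_sup_sElt_mul (K := K₀ ⊔ ⨆ i ∈ I, K i) ?_
      (union_image_subset_supportedOn hG hwK.2) (ih hw.2 hn.2 he.2 hwK.2 fun i hi => ?_) hn.1 he.1
    · simpa [Finset.erase_insert hk] using hd k (by simp)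
    · refine (hd i (by simp [hi])).mono_right (sup_le_sup_left ?_ _)
      exact biSup_mono fun a ha => Finset.erase_subset_erase _ (Finset.subset_insert _ _) ha

end Saturation

section BaseCase

variable {Γ : Type} [CommGroup Γ]

lemma augmentation_sub_mem {𝔟 : Ideal (MonoidAlgebra ℤ Γ)} (h : 𝔟.trivialActing = ⊤)
    (f : MonoidAlgebra ℤ Γ) :
    f - ((MonoidAlgebra.lift ℤ ℤ Γ 1 f : ℤ) : MonoidAlgebra ℤ Γ) ∈ 𝔟 := by
  induction f using MonoidAlgebra.induction_on with
  | of x =>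
    have : x ∈ 𝔟.trivialActing := h ▸ Subgroup.mem_top x
    simpa [Ideal.mem_trivialActing] using this
  | add x y hx hy =>
    rw [map_add, Int.cast_add, add_sub_add_comm]
    exact add_mem hx hy
  | smul a x hx =>
    rw [map_smul, smul_eq_mul, Int.cast_mul, zsmul_eq_mul, ← mul_sub]
    exact Ideal.mul_mem_left _ _ hx

lemma eq_zero_of_natCast_mul {n : ℕ} (hn : n ≠ 0) {x : MonoidAlgebra ℤ Γ}
    (h : (n : MonoidAlgebra ℤ Γ) * x = 0) : x = 0 := by
  rw [← nsmul_eq_mul] at h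
  ext a
  have := congrArg (fun y => y.coeff a) h
  simp only [MonoidAlgebra.coeff_smul, Finsupp.smul_apply] at this
  simpa [hn] using this

variable [Finite Γ]

lemma mem_sup_sElt_zpowers {x : Γ} {K : Subgroup Γ} (hd : Disjoint (Subgroup.zpowers x) K)
    {G : Set (MonoidAlgebra ℤ Γ)} (hG : G ⊆ supportedOn K) {f : MonoidAlgebra ℤ Γ}
    (hf : (MonoidAlgebra.of ℤ Γ x - 1) * f ∈ Ideal.span G) :
    f ∈ Ideal.span G ⊔ Ideal.span {sElt (Subgroup.zpowers x)} := by
  refine mem_sup_sElt_of_fixed hd hG ?_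
  rwa [Subgroup.zpowers_le, Ideal.mem_trivialActing, Submodule.mem_colon_singleton]

lemma mem_sup_sub_one {x : Γ} {K : Subgroup Γ} (hd : Disjoint (Subgroup.zpowers x) K)
    {G : Set (MonoidAlgebra ℤ Γ)} (hG : G ⊆ supportedOn K) {f : MonoidAlgebra ℤ Γ}
    (hf : sElt (Subgroup.zpowers x) * f ∈ Ideal.span G) :
    f ∈ Ideal.span G ⊔ Ideal.span {MonoidAlgebra.of ℤ Γ x - 1} := by
  refine mem_of_sElt_mul_mem hd hG hf le_sup_left ?_
  rw [Subgroup.zpowers_le, Ideal.mem_trivialActing]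
  exact Ideal.mem_sup_right (Ideal.mem_span_singleton_self _)

lemma sum_range_mul_pow {R : Type*} [CommRing R] {x : R} {d : ℕ} (hx : x ^ d = 1) (n : ℕ) :
    ∑ k ∈ Finset.range (n * d), x ^ k = n * ∑ k ∈ Finset.range d, x ^ k := by
  induction n with
  | zero => simp
  | succ n ih =>
    rw [Nat.succ_mul, Finset.sum_range_add, ih]
    simp [pow_add, mul_comm n d, pow_mul, hx, add_mul]

lemma augmentation_sElt (H : Subgroup Γ) :
    MonoidAlgebra.lift ℤ ℤ Γ 1 (sElt H) = (Nat.card H : ℤ) := by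
  have := Fintype.ofFinite H
  rw [sElt_eq_sum, map_sum]
  simp

/-- The ideal generated by the augmentation ideal of a subgroup is saturated. -/
lemma saturated_of_trivialActing {M : Subgroup Γ} {G : Set (MonoidAlgebra ℤ Γ)}
    (hGM : ∀ g ∈ G, sElt M * g = 0) (hM : M ≤ (Ideal.span G).trivialActing) {n : ℕ} (hn : n ≠ 0)
    {x : MonoidAlgebra ℤ Γ} (hx : (n : MonoidAlgebra ℤ Γ) * x ∈ Ideal.span G) :
    x ∈ Ideal.span G := by
  have hle : Ideal.span G ≤ (⊥ : Ideal (MonoidAlgebra ℤ Γ)).colon {sElt M} := by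
    refine Ideal.span_le.2 fun g hg => ?_
    rw [SetLike.mem_coe, Submodule.mem_colon_singleton, smul_eq_mul, mul_comm, hGM g hg]
    exact zero_mem _
  have h := Submodule.mem_colon_singleton.1 (hle hx)
  rw [smul_eq_mul, Ideal.mem_bot, mul_assoc] at h
  refine mem_of_sElt_mul_mem (K := ⊥) (G := ∅) disjoint_bot_right (Set.empty_subset _) ?_
    (by simp) hM
  rw [mul_comm, eq_zero_of_natCast_mul hn h]
  exact zero_mem _

lemma hasQuotientIso_zmod_of_trivialActing {M : Subgroup Γ} {τ j : Γ} {n : ℕ} (hn : n ≠ 0)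
    {G : Set (MonoidAlgebra ℤ Γ)} (hG : G ⊆ supportedOn M) (hGM : ∀ g ∈ G, sElt M * g = 0)
    (hM : M ≤ (Ideal.span G).trivialActing) (hd : Disjoint (Subgroup.zpowers τ) M)
    (hgen : Subgroup.zpowers τ ⊔ M = ⊤) (hjτ : j * τ⁻¹ ∈ M)
    (hord : orderOf j = n * orderOf τ) :
    HasQuotientIso ((Ideal.span G).colon {MonoidAlgebra.of ℤ Γ j - 1})
      (Ideal.span G ⊔ Ideal.span {sElt (Subgroup.zpowers j)}) (ZMod n) ∧
    HasQuotientIso ((Ideal.span G).colon {sElt (Subgroup.zpowers j)})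
      (Ideal.span G ⊔ Ideal.span {MonoidAlgebra.of ℤ Γ j - 1}) (ZMod 1) := by
  set 𝔞 := Ideal.span G with h𝔞
  set t := MonoidAlgebra.of ℤ Γ τ - 1 with ht
  set q := sElt (Subgroup.zpowers τ) with hq
  set a := MonoidAlgebra.of ℤ Γ j - 1 with ha
  set b := sElt (Subgroup.zpowers j) with hb
  have htq : t * q = 0 := sub_one_mul_sElt _ (Subgroup.mem_zpowers τ)
  have hat : a - t ∈ 𝔞 := by
    rw [show a - t = MonoidAlgebra.of ℤ Γ τ * (MonoidAlgebra.of ℤ Γ (j * τ⁻¹) - 1) by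
      rw [mul_sub, ← map_mul, mul_left_comm, mul_inv_cancel, mul_one, ha, ht]; ring]
    exact Ideal.mul_mem_left _ _ (hM hjτ)
  have hbq : b - n * q ∈ 𝔞 := by
    have e : Ideal.Quotient.mk 𝔞 (MonoidAlgebra.of ℤ Γ j) =
        Ideal.Quotient.mk 𝔞 (MonoidAlgebra.of ℤ Γ τ) := by
      rw [Ideal.Quotient.eq]
      simpa [ha, ht] using hat
    rw [← Ideal.Quotient.eq, hb, hq, sElt_zpowers, sElt_zpowers, hord, map_mul, map_natCast,
      map_sum, map_sum]
    simp_rw [map_pow, e]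
    rw [sum_range_mul_pow]
    rw [← map_pow, ← map_pow, pow_orderOf_eq_one, map_one, map_one]
  have hq' : ∀ x, q * x ∈ 𝔞 → x ∈ 𝔞 ⊔ Ideal.span {t} := fun x => mem_sup_sub_one hd hG
  constructor
  · have htop : (𝔞 ⊔ Ideal.span {t}).trivialActing = ⊤ := by
      rw [eq_top_iff, ← hgen, sup_le_iff, Subgroup.zpowers_le]
      exact ⟨Ideal.mem_sup_right (Ideal.mem_span_singleton_self _),
        fun h hh => Ideal.mem_sup_left (hM hh)⟩
    let ε := MonoidAlgebra.lift ℤ ℤ Γ 1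
    have hε : ∀ y ∈ 𝔞 ⊔ Ideal.span {t}, ε y = 0 := by
      have : 𝔞 ⊔ Ideal.span {t} ≤ RingHom.ker ε := by
        refine sup_le (Ideal.span_le.2 fun g hg => ?_) ?_
        · have h0 := congrArg ε (hGM g hg)
          rw [map_mul, augmentation_sElt, map_zero] at h0
          exact (mul_eq_zero.1 h0).resolve_left (mod_cast Nat.card_pos.ne')
        · rw [Ideal.span_singleton_le_iff_mem, RingHom.mem_ker]
          simp [ε, ht]
      exact this
    let ψ : (⊤ : Ideal (MonoidAlgebra ℤ Γ)) →+ ZMod n :=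
      ((Int.castAddHom (ZMod n)).comp ε.toAddMonoidHom).comp (Submodule.subtype _).toAddMonoidHom
    have hψ : ∀ y, ψ y = ((ε y : ℤ) : ZMod n) := fun y => rfl
    have hex : ∀ x ∈ 𝔞.colon {a}, ∃ y ∈ (⊤ : Ideal (MonoidAlgebra ℤ Γ)), 1 * x - q * y ∈ 𝔞 := by
      intro x hx
      have : t * x ∈ 𝔞 := by
        rw [show t * x = x • a - x * (a - t) by rw [smul_eq_mul]; ring]
        exact sub_mem (Submodule.mem_colon_singleton.1 hx) (Ideal.mul_mem_left _ _ hat)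
      obtain ⟨y, hy⟩ := mem_sup_span_singleton_iff.1 (mem_sup_sElt_zpowers hd hG this)
      exact ⟨y, trivial, by rwa [one_mul]⟩
    obtain ⟨φ, hφ⟩ := exists_addHom_of_relation ψ 1 q hex fun y hy => by
      rw [hψ, hε y (hq' _ hy), Int.cast_zero]
    refine ⟨φ, fun z => ?_, fun x => ?_⟩
    · obtain ⟨c, rfl⟩ := ZMod.intCast_surjective z
      refine ⟨⟨q * c, ?_⟩, ?_⟩
      · rw [Submodule.mem_colon_singleton, smul_eq_mul,
          show q * c * a = q * c * (a - t) by linear_combination c * htq]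
        exact Ideal.mul_mem_left _ _ hat
      · rw [hφ _ ⟨(c : MonoidAlgebra ℤ Γ), trivial⟩ (by simp), hψ]
        simp
    · obtain ⟨y, -, hy⟩ := hex x x.2
      rw [hφ x ⟨y, trivial⟩ hy, hψ, ZMod.intCast_zmod_eq_zero_iff_dvd, mem_sup_span_singleton_iff]
      constructor
      · rintro ⟨c, hc⟩
        obtain ⟨d, hd⟩ := mem_sup_span_singleton_iff.1 (augmentation_sub_mem htop y)
        change ε y = _ at hc
        change y - (ε y : MonoidAlgebra ℤ Γ) - t * d ∈ 𝔞 at hd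
        refine ⟨c, ?_⟩
        rw [hc] at hd
        push_cast at hd
        rw [show x - b * c = (1 * x - q * y) + q * (y - n * c - t * d) - c * (b - n * q) by
          linear_combination d * htq]
        exact sub_mem (add_mem hy (Ideal.mul_mem_left _ _ hd)) (Ideal.mul_mem_left _ _ hbq)
      · rintro ⟨c, hc⟩
        have := hε (y - n * c) (hq' _ (by
          rw [show q * (y - n * c) = (x - b * c) - (1 * x - q * y) + c * (b - n * q) by ring]
          exact add_mem (sub_mem hc hy) (Ideal.mul_mem_left _ _ hbq)))
        rw [map_sub, map_mul, map_natCast, sub_eq_zero] at this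
        exact ⟨_, this⟩
  · refine ⟨0, fun z => ⟨0, Subsingleton.elim _ _⟩, fun x => ⟨fun _ => ?_, fun _ => rfl⟩⟩
    have h1 : q * x ∈ 𝔞 := by
      refine saturated_of_trivialActing hGM hM hn ?_
      rw [show (n : MonoidAlgebra ℤ Γ) * (q * x) = x.1 • b - x * (b - n * q) by
        rw [smul_eq_mul]; ring]
      exact sub_mem (Submodule.mem_colon_singleton.1 x.2) (Ideal.mul_mem_left _ _ hbq)
    obtain ⟨c, hc⟩ := mem_sup_span_singleton_iff.1 (hq' _ h1)
    refine mem_sup_span_singleton_iff.2 ⟨c, ?_⟩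
    rw [show x - a * c = (x - t * c) - c * (a - t) by ring]
    exact sub_mem hc (Ideal.mul_mem_left _ _ hat)

end BaseCase

section Chain

variable {Γ : Type} [CommGroup Γ] [Finite Γ] {ι : Type*} [DecidableEq ι]

/-- The norm of `⟨τ i⟩` for `i ∈ V`, and the generator `τ i - 1` of the augmentation ideal of
`⟨τ i⟩` otherwise. -/
noncomputable def normOrAugmentation (τ : ι → Γ) (V : Finset ι) (i : ι) : MonoidAlgebra ℤ Γ :=
  if i ∈ V then sElt (Subgroup.zpowers (τ i)) else MonoidAlgebra.of ℤ Γ (τ i) - 1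

lemma normOrAugmentation_mem_supportedOn (τ : ι → Γ) (V : Finset ι) (i : ι) :
    normOrAugmentation τ V i ∈ supportedOn (Subgroup.zpowers (τ i)) := by
  unfold normOrAugmentation
  split_ifs
  · exact sElt_mem_supportedOn le_rfl
  · exact sub_one_mem_supportedOn (Subgroup.mem_zpowers _)

lemma hasQuotientIso_zmod_of_independent (E : Finset ι) (N : Subgroup Γ) (τ : ι → Γ) (j t : Γ)
    {n : ℕ} (hn : n ≠ 0)
    (hgen : Subgroup.zpowers t ⊔ (N ⊔ ⨆ i ∈ E, Subgroup.zpowers (τ i)) = ⊤)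
    (hτ : ∀ k ∈ E, Disjoint (Subgroup.zpowers (τ k)) (N ⊔ ⨆ i ∈ E.erase k, Subgroup.zpowers (τ i)))
    (hj : ∀ k ∈ E, Disjoint (Subgroup.zpowers j) (N ⊔ ⨆ i ∈ E.erase k, Subgroup.zpowers (τ i)))
    (ht : Disjoint (Subgroup.zpowers t) (N ⊔ ⨆ i ∈ E, Subgroup.zpowers (τ i)))
    (hjt : j * t⁻¹ ∈ N ⊔ ⨆ i ∈ E, Subgroup.zpowers (τ i))
    (hord : orderOf j = n * orderOf t) (V : Finset ι) (hV : V ⊆ E) (𝔞 : Ideal (MonoidAlgebra ℤ Γ))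
    (h𝔞 : 𝔞 = Ideal.span
      ((fun ν => MonoidAlgebra.of ℤ Γ ν - 1) '' N ∪ normOrAugmentation τ V '' ↑E)) :
    HasQuotientIso (𝔞.colon {MonoidAlgebra.of ℤ Γ j - 1})
      (𝔞 ⊔ Ideal.span {sElt (Subgroup.zpowers j)}) (ZMod (if Even V.card then n else 1)) ∧
    HasQuotientIso (𝔞.colon {sElt (Subgroup.zpowers j)})
      (𝔞 ⊔ Ideal.span {MonoidAlgebra.of ℤ Γ j - 1}) (ZMod (if Even V.card then 1 else n)) := by
  have hj0 : (MonoidAlgebra.of ℤ Γ j - 1) * sElt (Subgroup.zpowers j) = 0 :=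
    sub_one_mul_sElt _ (Subgroup.mem_zpowers j)
  have hsupp := image_sub_one_subset_supportedOn N
  subst h𝔞
  induction V using Finset.induction_on with
  | empty =>
    refine hasQuotientIso_zmod_of_trivialActing hn
      (union_image_subset_supportedOn hsupp fun i _ => normOrAugmentation_mem_supportedOn τ ∅ i)
      ?_ ?_ ht hgen hjt hord
    · rintro _ (⟨ν, hν, rfl⟩ | ⟨i, hi, rfl⟩)
      · rw [mul_comm, sub_one_mul_sElt _ (Subgroup.mem_sup_left hν)]
      · rw [normOrAugmentation, if_neg (Finset.notMem_empty i), mul_comm, sub_one_mul_sElt]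
        exact Subgroup.mem_sup_right
          (Subgroup.mem_iSup_of_mem i (Subgroup.mem_iSup_of_mem hi (Subgroup.mem_zpowers _)))
    · refine sup_le (fun ν hν => Ideal.subset_span (Or.inl ⟨ν, hν, rfl⟩))
        (iSup₂_le fun i hi => ?_)
      rw [Subgroup.zpowers_le]
      exact Ideal.subset_span (Or.inr ⟨i, hi, by simp [normOrAugmentation]⟩)
  | insert k V hk ih =>
    have hkE : k ∈ E := hV (Finset.mem_insert_self k V)
    specialize ih ((Finset.subset_insert k V).trans hV)
    have himg : normOrAugmentation τ (insert k V) '' ↑(E.erase k) =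
        normOrAugmentation τ V '' ↑(E.erase k) := by
      refine Set.image_congr fun i hi => ?_
      have : i ≠ k := Finset.ne_of_mem_erase hi
      simp [normOrAugmentation, this]
    rw [← Finset.insert_erase hkE, span_union_image_insert] at ih ⊢
    rw [himg]
    rw [normOrAugmentation, if_neg hk] at ih
    rw [show normOrAugmentation τ (insert k V) k = sElt (Subgroup.zpowers (τ k)) by
      simp [normOrAugmentation]]
    have hG := union_image_subset_supportedOn hsupp (I := E.erase k)
      fun i _ => normOrAugmentation_mem_supportedOn τ V i
    have hcard (a b : ℕ) :
        (if Even (insert k V).card then a else b) = if Even V.card then b else a := by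
      by_cases h : Even V.card <;> simp [Finset.card_insert_of_notMem hk, Nat.even_add_one, h]
    have huv : sElt (Subgroup.zpowers (τ k)) * (MonoidAlgebra.of ℤ Γ (τ k) - 1) = 0 := by
      rw [mul_comm, sub_one_mul_sElt _ (Subgroup.mem_zpowers _)]
    rw [hcard, hcard]
    exact ⟨ih.2.shift hj0 huv (fun x => mem_sup_sElt_zpowers (hj k hkE) hG)
      (fun x => mem_sup_sub_one (hj k hkE) hG) fun x => mem_sup_sub_one (hτ k hkE) hG,
      ih.1.shift (by rw [mul_comm, hj0]) huv (fun x => mem_sup_sub_one (hj k hkE) hG)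
      (fun x => mem_sup_sElt_zpowers (hj k hkE) hG) fun x => mem_sup_sub_one (hτ k hkE) hG⟩

end Chain

section Torsion

/-- Comparison of the `ℓ`-primary torsion of `R ⧸ S` with that of `R ⧸ 𝔟`, given an element `z`
acting like an integer prime to `ℓ` and carrying `𝔟` into `S ≤ 𝔟`. -/
lemma HasQuotientIso.nonempty_torsion_equiv {R A : Type*} [CommRing R] [AddCommGroup A]
    {C 𝔟 S : Ideal R} (h : HasQuotientIso C 𝔟 A) {ℓ ν : ℕ} {z : R} (hν : ℓ.Coprime ν)
    (hC : ∀ x, x ∈ C ↔ ∃ k : ℕ, (ℓ : R) ^ k * x ∈ 𝔟) (hS : S ≤ 𝔟) (hz : ∀ y ∈ 𝔟, z * y ∈ S)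
    (hz𝔟 : ∀ y, z * y - ν * y ∈ 𝔟)
    (hzS : ∀ (k : ℕ) (x : R), (ℓ : R) ^ k * x ∈ S → z * x - ν * x ∈ S)
    (hA : ∀ a : A, ∃ a', ν • a' = a) :
    Nonempty (Submodule.torsion' ℤ (R ⧸ S) (Submonoid.powers (ℓ : ℤ)) ≃+ A) := by
  obtain ⟨φ, hφs, hφ⟩ := h
  have htors : ∀ x : R, Ideal.Quotient.mk S x ∈
      Submodule.torsion' ℤ (R ⧸ S) (Submonoid.powers (ℓ : ℤ)) ↔ ∃ k : ℕ, (ℓ : R) ^ k * x ∈ S := by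
    intro x
    rw [Submodule.mem_torsion'_iff]
    have key : ∀ k : ℕ, ((ℓ : ℤ) ^ k) • Ideal.Quotient.mk S x = 0 ↔ (ℓ : R) ^ k * x ∈ S := by
      intro k
      rw [← Ideal.Quotient.eq_zero_iff_mem, ← map_zsmul, zsmul_eq_mul]
      push_cast
      rfl
    constructor
    · rintro ⟨⟨_, k, rfl⟩, hk⟩
      exact ⟨k, (key k).1 hk⟩
    · rintro ⟨k, hk⟩
      exact ⟨⟨_, k, rfl⟩, (key k).2 hk⟩
  let D : AddSubgroup R :=
    (Submodule.torsion' ℤ (R ⧸ S) (Submonoid.powers (ℓ : ℤ))).toAddSubgroup.comap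
      (Ideal.Quotient.mk S).toAddMonoidHom
  have hD : ∀ x, x ∈ D ↔ ∃ k : ℕ, (ℓ : R) ^ k * x ∈ S := htors
  have hDC : D ≤ C.toAddSubgroup := fun x hx => by
    obtain ⟨k, hk⟩ := (hD x).1 hx
    exact (hC x).2 ⟨k, hS hk⟩
  let f : D →+ A := φ.comp (AddSubgroup.inclusion hDC)
  let p : D →+ Submodule.torsion' ℤ (R ⧸ S) (Submonoid.powers (ℓ : ℤ)) :=
    ((Ideal.Quotient.mk S).toAddMonoidHom.comp D.subtype).codRestrict
      (Submodule.torsion' ℤ (R ⧸ S) (Submonoid.powers (ℓ : ℤ))).toAddSubgroup fun x => x.2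
  have hp : Function.Surjective p := by
    rintro ⟨y, hy⟩
    obtain ⟨x, rfl⟩ := Ideal.Quotient.mk_surjective y
    exact ⟨⟨x, hy⟩, rfl⟩
  have hf : Function.Surjective f := by
    intro a
    obtain ⟨a', rfl⟩ := hA a
    obtain ⟨y, rfl⟩ := hφs a'
    obtain ⟨k, hk⟩ := (hC y).1 y.2
    refine ⟨⟨z * y, (hD _).2 ⟨k, ?_⟩⟩, ?_⟩
    · rw [mul_left_comm]
      exact hz _ hk
    · rw [← map_nsmul, ← sub_eq_zero]
      change φ _ - _ = 0
      rw [← map_sub, hφ]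
      have := hz𝔟 y
      rwa [← nsmul_eq_mul] at this
  have hker : p.ker = f.ker := by
    ext x
    have h1 : x ∈ p.ker ↔ (x : R) ∈ S := by
      rw [AddMonoidHom.mem_ker, ← Ideal.Quotient.eq_zero_iff_mem]
      exact Subtype.ext_iff
    have h2 : x ∈ f.ker ↔ (x : R) ∈ 𝔟 := hφ _
    rw [h1, h2]
    refine ⟨fun h => hS h, fun h => ?_⟩
    obtain ⟨k, hk⟩ := (hD x).1 x.2
    have h3 : (ν : R) * x ∈ S := by
      rw [← sub_sub_self (z * (x : R)) (ν * x)]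
      exact sub_mem (hz _ h) (hzS k _ hk)
    exact Ideal.mem_of_coprime_mul_mem (hν.pow_left k) (by exact_mod_cast hk) h3
  exact ⟨(QuotientAddGroup.quotientKerEquivOfSurjective p hp).symm.trans
    ((QuotientAddGroup.quotientAddEquivOfEq hker).trans
      (QuotientAddGroup.quotientKerEquivOfSurjective f hf))⟩

end Torsion

section Independence

variable {Γ : Type} [CommGroup Γ]

lemma disjoint_zpowers_of_pow_mem {x : Γ} {K L : Subgroup Γ} {c : ℕ}
    (hc : (orderOf x).Coprime c) (hK : ∀ y ∈ K, y ^ c ∈ L)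
    (hd : Disjoint (Subgroup.zpowers x) L) : Disjoint (Subgroup.zpowers x) K := by
  rw [Subgroup.disjoint_def] at hd ⊢
  intro y hyx hyK
  have h1 := hd (pow_mem hyx c) (hK y hyK)
  rw [← orderOf_eq_one_iff]
  exact Nat.eq_one_of_dvd_coprimes hc (orderOf_dvd_of_mem_zpowers hyx)
    (orderOf_dvd_of_pow_eq_one h1)

lemma pow_mem_biSup {ι : Type*} {I : Finset ι} {K L : ι → Subgroup Γ} {c : ℕ}
    (h : ∀ i ∈ I, ∀ y ∈ K i, y ^ c ∈ L i) {y : Γ} (hy : y ∈ ⨆ i ∈ I, K i) :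
    y ^ c ∈ ⨆ i ∈ I, L i := by
  have : ⨆ i ∈ I, K i ≤ (⨆ i ∈ I, L i).comap (powMonoidHom c) :=
    iSup₂_le fun i hi x hx => (le_iSup₂_of_le i hi le_rfl : L i ≤ ⨆ i ∈ I, L i) (h i hi x hx)
  exact this hy

lemma biSup_le_iSup_ne {ι : Type*} {t : ι → Subgroup Γ} {I : Finset ι} {k : ι}
    (hk : k ∉ I) : ⨆ i ∈ I, t i ≤ ⨆ i, ⨆ (_ : i ≠ k), t i :=
  biSup_mono fun _ hi => ne_of_mem_of_not_mem hi hk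

lemma prod_pow_mem_biSup {ι : Type*} {τ : ι → Γ} (s : Finset ι) (f : ι → ℕ) :
    ∏ i ∈ s, τ i ^ f i ∈ ⨆ i ∈ s, Subgroup.zpowers (τ i) :=
  Subgroup.prod_mem _ fun i hi => Subgroup.mem_iSup_of_mem i
    (Subgroup.mem_iSup_of_mem hi (Subgroup.npow_mem_zpowers _ _))

variable {ι : Type*} [Fintype ι] {τ : ι → Γ} {g : ι → ℕ} {lst : ι} {j : Γ}

lemma diagonal_pow_eq_one
    (hdvd : ∀ i, g lst ∣ g i) (hord : ∀ i, i ≠ lst → orderOf (τ i) = g i)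
    (hordlst : orderOf (τ lst) ∣ g lst) (hj : j = ∏ i, τ i ^ (g i / g lst)) :
    j ^ g lst = 1 := by
  rw [hj, ← Finset.prod_pow]
  refine Finset.prod_eq_one fun i _ => ?_
  rw [← pow_mul, Nat.div_mul_cancel (hdvd i)]
  by_cases h : i = lst
  · subst h
    exact orderOf_dvd_iff_pow_eq_one.1 hordlst
  · rw [← hord i h, pow_orderOf_eq_one]

lemma dvd_of_diagonal_pow_mem
    (hindep : iSupIndep fun i => Subgroup.zpowers (τ i)) (hg : ∀ i, g i ≠ 0)
    (hdvd : ∀ i, g lst ∣ g i) (hord : ∀ i, i ≠ lst → orderOf (τ i) = g i)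
    (hj : j = ∏ i, τ i ^ (g i / g lst))
    {i₀ : ι} (hi₀ : i₀ ≠ lst) {b : ℕ}
    (hb : j ^ b ∈ ⨆ i, ⨆ (_ : i ≠ i₀), Subgroup.zpowers (τ i)) : g lst ∣ b := by
  classical
  have h1 : j = τ i₀ ^ (g i₀ / g lst) * ∏ i ∈ Finset.univ.erase i₀, τ i ^ (g i / g lst) := by
    rw [hj, Finset.mul_prod_erase _ (fun i => τ i ^ (g i / g lst)) (Finset.mem_univ i₀)]
  have h2 : τ i₀ ^ (g i₀ / g lst * b) = 1 := by
    refine Subgroup.disjoint_def.1 (hindep i₀) (Subgroup.npow_mem_zpowers _ _) ?_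
    rw [h1, mul_pow, ← pow_mul] at hb
    exact (Subgroup.mul_mem_cancel_right _ (pow_mem (biSup_le_iSup_ne (Finset.notMem_erase _ _)
      (prod_pow_mem_biSup _ _)) b)).1 hb
  have h3 := orderOf_dvd_of_pow_eq_one h2
  rw [hord i₀ hi₀] at h3
  obtain ⟨d, hd⟩ := hdvd i₀
  have hd0 : 0 < d := Nat.pos_of_ne_zero fun h => hg i₀ (by rw [hd, h, mul_zero])
  rw [hd, Nat.mul_div_cancel_left _ (Nat.pos_of_ne_zero (hg lst)), mul_comm] at h3
  exact Nat.dvd_of_mul_dvd_mul_left hd0 h3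

/-- Omitting any one of the `m` cyclic groups leaves an independent family. -/
lemma disjoint_update_diagonal [Finite Γ] [DecidableEq ι]
    (hindep : iSupIndep fun i => Subgroup.zpowers (τ i)) (hg : ∀ i, g i ≠ 0)
    (hdvd : ∀ i, g lst ∣ g i) (hord : ∀ i, i ≠ lst → orderOf (τ i) = g i)
    (hordlst : orderOf (τ lst) ∣ g lst) (hj : j = ∏ i, τ i ^ (g i / g lst))
    {i₀ k : ι} (hk : k ≠ i₀) :
    Disjoint (Subgroup.zpowers (Function.update τ lst j k))
      (⨆ i ∈ (Finset.univ.erase i₀).erase k, Subgroup.zpowers (Function.update τ lst j i)) := by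
  have hσ : ∀ i, i ≠ lst → Function.update τ lst j i = τ i := fun i hi =>
    Function.update_of_ne hi _ _
  have hj1 : ∀ b : ℕ, i₀ ≠ lst → j ^ b ∈ ⨆ i, ⨆ (_ : i ≠ i₀), Subgroup.zpowers (τ i) →
      j ^ b = 1 := fun b h hb => by
    obtain ⟨d, rfl⟩ := dvd_of_diagonal_pow_mem hindep hg hdvd hord hj h hb
    rw [pow_mul, diagonal_pow_eq_one hdvd hord hordlst hj, one_pow]
  have hcongr : ∀ I : Finset ι, lst ∉ I → ⨆ i ∈ I, Subgroup.zpowers (Function.update τ lst j i) =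
      ⨆ i ∈ I, Subgroup.zpowers (τ i) := fun I hI =>
    iSup_congr fun i => iSup_congr fun hi => by rw [hσ i (ne_of_mem_of_not_mem hi hI)]
  by_cases hi₀ : i₀ = lst
  · subst hi₀
    rw [hcongr _ (by simp), hσ k hk]
    exact (hindep k).mono_right (biSup_le_iSup_ne (Finset.notMem_erase _ _))
  by_cases hkl : k = lst
  · subst hkl
    rw [hcongr _ (by simp), Function.update_self, Subgroup.disjoint_def]
    intro y hy hyL
    obtain ⟨b, rfl⟩ := (mem_powers_iff_mem_zpowers).2 hy
    exact hj1 b hi₀ (biSup_le_iSup_ne (by simp) hyL)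
  · have hlst : lst ∈ (Finset.univ.erase i₀).erase k := by simp [Ne.symm hkl, Ne.symm hi₀]
    rw [hσ k hkl, ← Finset.insert_erase hlst, Finset.iSup_insert, hcongr _ (by simp),
      Function.update_self, Subgroup.disjoint_def]
    intro y hy hyL
    obtain ⟨_, hz, w, hw, rfl⟩ := Subgroup.mem_sup.1 hyL
    obtain ⟨b, rfl⟩ := (mem_powers_iff_mem_zpowers).2 hz
    have h1 : j ^ b = 1 := by
      refine hj1 b hi₀ ?_
      have h2 : w ∈ ⨆ i, ⨆ (_ : i ≠ i₀), Subgroup.zpowers (τ i) := biSup_le_iSup_ne (by simp) hw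
      refine (Subgroup.mul_mem_cancel_right _ h2).1 ?_
      exact (le_iSup₂_of_le (f := fun i (_ : i ≠ i₀) => Subgroup.zpowers (τ i)) k hk le_rfl) hy
    simp only [h1, one_mul] at hy ⊢
    exact Subgroup.disjoint_def.1 (hindep k) hy (biSup_le_iSup_ne (by simp) hw)

end Independence

section PrimeToPart

variable {Γ : Type} [CommGroup Γ]

/-- The subgroup of elements killed by `n`. -/
def powKer (Γ : Type) [CommGroup Γ] (n : ℕ) : Subgroup Γ := (powMonoidHom n : Γ →* Γ).ker

lemma mem_powKer {n : ℕ} {x : Γ} : x ∈ powKer Γ n ↔ x ^ n = 1 := Iff.rfl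

lemma coprime_card_of_le_powKer [Finite Γ] {ℓ c : ℕ} (hℓ : ℓ.Prime) (hc : ℓ.Coprime c)
    {H : Subgroup Γ} (hH : H ≤ powKer Γ c) : ℓ.Coprime (Nat.card H) := by
  rw [hℓ.coprime_iff_not_dvd]
  intro hd
  have := Fact.mk hℓ
  obtain ⟨⟨x, hx⟩, hxo⟩ := exists_prime_orderOf_dvd_card' ℓ hd
  rw [Subgroup.orderOf_mk] at hxo
  have h1 : ℓ ∣ c := hxo ▸ orderOf_dvd_of_pow_eq_one (hH hx)
  exact hℓ.coprime_iff_not_dvd.1 hc h1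

lemma disjoint_powKer {a c : ℕ} (hac : a.Coprime c) : Disjoint (powKer Γ a) (powKer Γ c) := by
  rw [Subgroup.disjoint_def]
  intro x h1 h2
  rw [← orderOf_eq_one_iff]
  exact Nat.eq_one_of_dvd_coprimes hac (orderOf_dvd_of_pow_eq_one h1)
    (orderOf_dvd_of_pow_eq_one h2)

lemma pow_mem_powKer {a c : ℕ} (hexp : ∀ x : Γ, x ^ (a * c) = 1) (x : Γ) :
    x ^ c ∈ powKer Γ a := by
  rw [mem_powKer, ← pow_mul, mul_comm, hexp]

lemma inf_powKer_sup_inf_powKer {a c : ℕ} (hac : a.Coprime c) (hexp : ∀ x : Γ, x ^ (a * c) = 1)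
    (H : Subgroup Γ) : H ⊓ powKer Γ a ⊔ H ⊓ powKer Γ c = H := by
  refine le_antisymm (sup_le inf_le_left inf_le_left) fun x hx => ?_
  have h : x = (x ^ c) ^ (a.gcdB c) * (x ^ a) ^ (a.gcdA c) := by
    rw [← zpow_natCast, ← zpow_natCast, ← zpow_mul, ← zpow_mul, ← zpow_add, add_comm,
      ← Nat.gcd_eq_gcd_ab, hac.gcd_eq_one, Nat.cast_one, zpow_one]
  rw [h]
  have h1 : x ^ c ∈ H ⊓ powKer Γ a := ⟨pow_mem hx c, pow_mem_powKer hexp x⟩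
  have h2 : x ^ a ∈ H ⊓ powKer Γ c :=
    ⟨pow_mem hx a, pow_mem_powKer (fun y => by rw [mul_comm, hexp]) x⟩
  exact Subgroup.mul_mem_sup (zpow_mem h1 _) (zpow_mem h2 _)

lemma primaryComponent_eq_powKer {ℓ e c : ℕ} [Fact ℓ.Prime] (hc : ℓ.Coprime c)
    (hexp : ∀ x : Γ, x ^ (ℓ ^ e * c) = 1) :
    CommGroup.primaryComponent Γ ℓ = powKer Γ (ℓ ^ e) := by
  ext x
  rw [CommGroup.mem_primaryComponent]
  refine ⟨fun ⟨k, hk⟩ => ?_, fun h => ⟨e, h⟩⟩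
  have h1 : (orderOf x).Coprime c :=
    (Nat.Coprime.pow_left k hc).coprime_dvd_left (orderOf_dvd_of_pow_eq_one hk)
  exact orderOf_dvd_iff_pow_eq_one.1 (h1.dvd_of_dvd_mul_right (orderOf_dvd_of_pow_eq_one (hexp x)))

end PrimeToPart

section TorsionOfNormQuotient

lemma zpowers_le_trivialActing_colon {Γ : Type} [CommGroup Γ] {𝔞 : Ideal (MonoidAlgebra ℤ Γ)}
    {j : Γ} {x : MonoidAlgebra ℤ Γ} (hx : x * (MonoidAlgebra.of ℤ Γ j - 1) ∈ 𝔞) :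
    Subgroup.zpowers j ≤ (𝔞.colon {x}).trivialActing := by
  rw [Subgroup.zpowers_le, Ideal.mem_trivialActing, Submodule.mem_colon_singleton, smul_eq_mul,
    mul_comm]
  exact hx

variable {Γ : Type} [CommGroup Γ] [Finite Γ]

lemma sElt_mul_sub_card_mul_mem {H : Subgroup Γ} {𝔟 : Ideal (MonoidAlgebra ℤ Γ)}
    {y : MonoidAlgebra ℤ Γ} (h : ∀ h ∈ H, (MonoidAlgebra.of ℤ Γ h - 1) * y ∈ 𝔟) :
    sElt H * y - (Nat.card H : MonoidAlgebra ℤ Γ) * y ∈ 𝔟 := by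
  have := Fintype.ofFinite H
  have : sElt H * y - (Nat.card H : MonoidAlgebra ℤ Γ) * y =
      ∑ h : H, (MonoidAlgebra.of ℤ Γ (h : Γ) - 1) * y := by
    rw [← Finset.sum_mul, Finset.sum_sub_distrib, sElt_eq_sum]
    simp [sub_mul, Nat.card_eq_fintype_card]
  rw [this]
  exact Ideal.sum_mem _ fun i _ => h i i.2

lemma mem_colon_sub_one_iff {𝔞 : Ideal (MonoidAlgebra ℤ Γ)} {j : Γ} {ℓ n : ℕ}
    (hord : orderOf j = ℓ ^ n)
    (hsat : ∀ x, (ℓ : MonoidAlgebra ℤ Γ) * x ∈ 𝔞 → x ∈ 𝔞) (x : MonoidAlgebra ℤ Γ) :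
    x ∈ 𝔞.colon {MonoidAlgebra.of ℤ Γ j - 1} ↔
      ∃ k : ℕ, (ℓ : MonoidAlgebra ℤ Γ) ^ k * x ∈ 𝔞 ⊔ Ideal.span {sElt (Subgroup.zpowers j)} := by
  rw [Submodule.mem_colon_singleton, smul_eq_mul]
  constructor
  · intro hx
    refine ⟨n, mem_sup_span_singleton_iff.2 ⟨x, ?_⟩⟩
    have h1 := sElt_mul_sub_card_mul_mem (H := Subgroup.zpowers j) (𝔟 := 𝔞) (y := x) fun h hh => by
      have := zpowers_le_trivialActing_colon hx hh
      rwa [Ideal.mem_trivialActing, Submodule.mem_colon_singleton, smul_eq_mul] at this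
    rw [Nat.card_zpowers, hord, Nat.cast_pow] at h1
    rw [← neg_sub]
    exact neg_mem h1
  · rintro ⟨k, hk⟩
    obtain ⟨c, hc⟩ := mem_sup_span_singleton_iff.1 hk
    refine Ideal.mem_of_pow_mul_mem hsat k ?_
    have h1 := 𝔞.mul_mem_left (MonoidAlgebra.of ℤ Γ j - 1) hc
    have h2 := sub_one_mul_sElt _ (Subgroup.mem_zpowers j)
    convert h1 using 1
    linear_combination c * h2

lemma sElt_mem_span_sElt_of_le {H K : Subgroup Γ} (h : H ≤ K) :
    sElt K ∈ Ideal.span {sElt H} := by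
  have := mem_sup_sElt_of_fixed (H := H) (K := ⊥) (G := ∅) disjoint_bot_right
    (Set.empty_subset _) (f := sElt K) fun x hx => by
      rw [Ideal.mem_trivialActing, Submodule.mem_colon_singleton, smul_eq_mul,
        sub_one_mul_sElt K (h hx)]
      exact zero_mem _
  simpa using this

variable {ι : Type*} {T : ι → Subgroup Γ} {σ : ι → Γ} {ℓ a c : ℕ}

lemma sElt_eq_mul_sElt_inf (hac : a.Coprime c) (hexp : ∀ x : Γ, x ^ (a * c) = 1)
    (hT : ∀ i, T i ⊓ powKer Γ a = Subgroup.zpowers (σ i)) (i : ι) :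
    sElt (T i) = sElt (Subgroup.zpowers (σ i)) * sElt (T i ⊓ powKer Γ c) := by
  refine sElt_mul_of_disjoint ?_ ?_
  · rw [← hT]
    exact (disjoint_powKer hac).mono inf_le_right inf_le_right
  · rw [← hT, inf_powKer_sup_inf_powKer hac hexp]

/-- The augmentation ideal of a subgroup, together with the norms of cyclic
subgroups independent of it, generates an `ℓ`-saturated ideal. -/
lemma saturated_span_sub_one_union_sElt [DecidableEq ι] {E : Finset ι} {N : Subgroup Γ}
    (hℓ : ℓ ≠ 0)
    (hσ : ∀ k ∈ E, Disjoint (Subgroup.zpowers (σ k))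
      (N ⊔ ⨆ i ∈ E.erase k, Subgroup.zpowers (σ i))) :
    ∀ x, (ℓ : MonoidAlgebra ℤ Γ) * x ∈
        Ideal.span ((fun ν => MonoidAlgebra.of ℤ Γ ν - 1) '' (N : Set Γ) ∪
          (fun i => sElt (Subgroup.zpowers (σ i))) '' ↑E) →
      x ∈ Ideal.span ((fun ν => MonoidAlgebra.of ℤ Γ ν - 1) '' (N : Set Γ) ∪
          (fun i => sElt (Subgroup.zpowers (σ i))) '' ↑E) := by
  refine saturated_span_norms (image_sub_one_subset_supportedOn N) (fun x hx => ?_)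
    (fun i => Subgroup.zpowers (σ i)) (fun i => Subgroup.zpowers (σ i))
    (fun i => sElt (Subgroup.zpowers (σ i))) (fun _ => 1) (fun _ => 1) E
    (fun i _ => (mul_one _).symm) (fun i _ => Nat.coprime_one_right ℓ)
    (fun i _ => by rw [Nat.cast_one]) (fun i _ => sElt_mem_supportedOn le_rfl) hσ
  refine saturated_of_trivialActing (M := N) ?_ (fun ν hν => ?_) hℓ hx
  · rintro _ ⟨ν, hν, rfl⟩
    rw [mul_comm]
    exact sub_one_mul_sElt N hν
  · exact Ideal.mem_trivialActing.2 (Ideal.subset_span ⟨ν, hν, rfl⟩)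

variable [Fintype ι] [DecidableEq ι]

/-- Omitting one of the norms `s(T i)` leaves a family generating an `ℓ`-saturated ideal. -/
lemma saturated_span_sElt_erase (hℓ : ℓ.Prime) (hℓc : ℓ.Coprime c) (hac : a.Coprime c)
    (hexp : ∀ x : Γ, x ^ (a * c) = 1)
    (hT : ∀ i, T i ⊓ powKer Γ a = Subgroup.zpowers (σ i))
    (hσ : ∀ i₀ k, k ≠ i₀ → Disjoint (Subgroup.zpowers (σ k))
      (⨆ i ∈ (Finset.univ.erase i₀).erase k, Subgroup.zpowers (σ i))) (i₀ : ι)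
    (x : MonoidAlgebra ℤ Γ)
    (hx : (ℓ : MonoidAlgebra ℤ Γ) * x ∈
      Ideal.span ((fun i => sElt (T i)) '' ↑(Finset.univ.erase i₀))) :
    x ∈ Ideal.span ((fun i => sElt (T i)) '' ↑(Finset.univ.erase i₀)) := by
  have hσa : ∀ i, σ i ∈ T i ⊓ powKer Γ a := fun i => (hT i).symm ▸ Subgroup.mem_zpowers _
  have := saturated_span_norms (ℓ := ℓ) (G := (∅ : Set (MonoidAlgebra ℤ Γ))) (K₀ := ⊥)
    (Set.empty_subset _) (fun x hx => by
      rw [Ideal.span_empty, Ideal.mem_bot] at hx ⊢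
      exact eq_zero_of_natCast_mul hℓ.ne_zero hx)
    (fun i => Subgroup.zpowers (σ i)) T (fun i => sElt (T i)) (fun i => sElt (T i ⊓ powKer Γ c))
    (fun i => Nat.card (T i ⊓ powKer Γ c : Subgroup Γ)) (Finset.univ.erase i₀)
    (fun i _ => sElt_eq_mul_sElt_inf hac hexp hT i)
    (fun i _ => coprime_card_of_le_powKer hℓ hℓc inf_le_right)
    (fun i _ => sElt_mul_self _) (fun i _ => sElt_mem_supportedOn le_rfl)
    (fun k hk => by
      rw [bot_sup_eq]
      refine disjoint_zpowers_of_pow_mem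
        (hac.coprime_dvd_left (orderOf_dvd_of_pow_eq_one (hσa k).2))
        (fun y hy => pow_mem_biSup (fun i _ z hz => ?_) hy) (hσ i₀ k (Finset.ne_of_mem_erase hk))
      rw [← hT]
      exact ⟨pow_mem hz c, pow_mem_powKer hexp z⟩) x
  rw [Set.empty_union] at this
  exact this hx

lemma powKer_le_trivialActing_colon (hℓ : ℓ.Prime) (hℓc : ℓ.Coprime c) (hac : a.Coprime c)
    (hexp : ∀ x : Γ, x ^ (a * c) = 1) (hTgen : ⨆ i, T i = ⊤)
    (hT : ∀ i, T i ⊓ powKer Γ a = Subgroup.zpowers (σ i))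
    (hσ : ∀ i₀ k, k ≠ i₀ → Disjoint (Subgroup.zpowers (σ k))
      (⨆ i ∈ (Finset.univ.erase i₀).erase k, Subgroup.zpowers (σ i)))
    {k : ℕ} {x : MonoidAlgebra ℤ Γ}
    (hx : (ℓ : MonoidAlgebra ℤ Γ) ^ k * x ∈ Ideal.span (Set.range fun i => sElt (T i))) :
    powKer Γ c ≤ ((Ideal.span (Set.range fun i => sElt (T i))).colon {x}).trivialActing := by
  set S := Ideal.span (Set.range fun i => sElt (T i)) with hS
  have h1 : ∀ i₀, T i₀ ⊓ powKer Γ c ≤ (S.colon {x}).trivialActing := fun i₀ γ hγ => by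
    rw [Ideal.mem_trivialActing, Submodule.mem_colon_singleton, smul_eq_mul]
    refine Ideal.span_mono (Set.image_subset_range _ _) (Ideal.mem_of_pow_mul_mem
      (saturated_span_sElt_erase hℓ hℓc hac hexp hT hσ i₀) k ?_)
    have h2 : S = Ideal.span ((fun i => sElt (T i)) '' ↑(Finset.univ.erase i₀)) ⊔
        Ideal.span {sElt (T i₀)} := by
      rw [← Ideal.span_union, Set.union_singleton, ← Set.image_insert_eq (f := fun i => sElt (T i)),
        ← Finset.coe_insert, Finset.insert_erase (Finset.mem_univ _), Finset.coe_univ,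
        Set.image_univ]
    rw [h2] at hx
    obtain ⟨d, hd⟩ := mem_sup_span_singleton_iff.1 hx
    have h3 := Ideal.mul_mem_left _ (MonoidAlgebra.of ℤ Γ γ - 1) hd
    have h4 := sub_one_mul_sElt (T i₀) hγ.1
    convert h3 using 1
    linear_combination d * h4
  have h5 : ∀ γ : Γ, γ ^ a ∈ (S.colon {x}).trivialActing := by
    have : (⊤ : Subgroup Γ) ≤ (S.colon {x}).trivialActing.comap (powMonoidHom a) := by
      rw [← hTgen]
      exact iSup_le fun i γ hγ => h1 i ⟨pow_mem hγ a,
        pow_mem_powKer (fun y => by rw [mul_comm, hexp]) γ⟩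
    exact fun γ => this (Subgroup.mem_top γ)
  intro γ hγ
  obtain ⟨n, hn⟩ := exists_pow_eq_self_of_coprime (x := γ) (n := a)
    (hac.coprime_dvd_right (orderOf_dvd_of_pow_eq_one hγ))
  rw [← hn]
  exact pow_mem (h5 γ) n

lemma exists_nsmul_eq_zmod {k n : ℕ} (h : k.Coprime n) (y : ZMod n) :
    ∃ y' : ZMod n, k • y' = y := by
  refine ⟨(ZMod.unitOfCoprime k h)⁻¹ * y, ?_⟩
  rw [nsmul_eq_mul, ← mul_assoc, ← ZMod.coe_unitOfCoprime k h, Units.mul_inv, one_mul]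

/-- The `ℓ`-primary torsion of `ℤ[Γ]/(s(T i))_i` when the `ℓ`-parts of the `T i` are generated by
`m` elements `σ i`, any `m - 1` of which are independent. -/
lemma nonempty_torsion_equiv_zmod (hℓ : ℓ.Prime) (hℓc : ℓ.Coprime c) (hac : a.Coprime c)
    (hexp : ∀ x : Γ, x ^ (a * c) = 1) (hTgen : ⨆ i, T i = ⊤)
    (hT : ∀ i, T i ⊓ powKer Γ a = Subgroup.zpowers (σ i))
    (hσ : ∀ i₀ k, k ≠ i₀ → Disjoint (Subgroup.zpowers (σ k))
      (⨆ i ∈ (Finset.univ.erase i₀).erase k, Subgroup.zpowers (σ i)))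
    {lst : ι} {t : Γ} {n r : ℕ} (hjord : orderOf (σ lst) = ℓ ^ n)
    (ht : Disjoint (Subgroup.zpowers t) (⨆ i ∈ Finset.univ.erase lst, Subgroup.zpowers (σ i)))
    (hgen : Subgroup.zpowers t ⊔ ⨆ i ∈ Finset.univ.erase lst, Subgroup.zpowers (σ i) = powKer Γ a)
    (hjt : σ lst * t⁻¹ ∈ ⨆ i ∈ Finset.univ.erase lst, Subgroup.zpowers (σ i))
    (hord : orderOf (σ lst) = ℓ ^ r * orderOf t) :
    Nonempty (Submodule.torsion' ℤ
      (MonoidAlgebra ℤ Γ ⧸ Ideal.span (Set.range fun i => sElt (T i)))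
      (Submonoid.powers (ℓ : ℤ)) ≃+ ZMod (if Even (Fintype.card ι - 1) then ℓ ^ r else 1)) := by
  set S := Ideal.span (Set.range fun i => sElt (T i)) with hS
  set E := Finset.univ.erase lst with hE
  have hcop : ∀ x ∈ powKer Γ a, (orderOf x).Coprime c := fun x hx =>
    hac.coprime_dvd_left (orderOf_dvd_of_pow_eq_one hx)
  have hσa : ∀ i, σ i ∈ powKer Γ a := fun i =>
    ((hT i).symm ▸ Subgroup.mem_zpowers _ : σ i ∈ T i ⊓ powKer Γ a).2
  have hta : t ∈ powKer Γ a := hgen ▸ Subgroup.mem_sup_left (Subgroup.mem_zpowers t)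
  have hdisj : ∀ x ∈ powKer Γ a, ∀ L : Subgroup Γ, Disjoint (Subgroup.zpowers x) L →
      Disjoint (Subgroup.zpowers x) (powKer Γ c ⊔ L) := fun x hx L hL => by
    refine disjoint_zpowers_of_pow_mem (hcop x hx) (fun y hy => ?_) hL
    obtain ⟨u, hu, v, hv, rfl⟩ := Subgroup.mem_sup.1 hy
    rw [mul_pow, mem_powKer.1 hu, one_mul]
    exact pow_mem hv c
  have hσE : ∀ k ∈ E, Disjoint (Subgroup.zpowers (σ k))
      (powKer Γ c ⊔ ⨆ i ∈ E.erase k, Subgroup.zpowers (σ i)) := fun k hk =>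
    hdisj _ (hσa k) _ (hσ lst k (Finset.ne_of_mem_erase hk))
  set 𝔞 := Ideal.span ((fun ν => MonoidAlgebra.of ℤ Γ ν - 1) '' (powKer Γ c : Set Γ) ∪
    (fun i => sElt (Subgroup.zpowers (σ i))) '' ↑E) with h𝔞
  have hquot := (hasQuotientIso_zmod_of_independent E (powKer Γ c) σ (σ lst) t
    (pow_ne_zero r hℓ.ne_zero) (by
      rw [sup_left_comm, hgen, sup_comm]
      simpa using inf_powKer_sup_inf_powKer hac hexp ⊤) hσE
    (fun k hk => hdisj _ (hσa lst) _ (by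
      rw [hE, Finset.erase_right_comm]
      exact hσ k lst (Finset.ne_of_mem_erase hk).symm))
    (hdisj t hta _ ht) (Subgroup.mem_sup_right hjt) hord E subset_rfl 𝔞 (by
      rw [h𝔞]
      congr 2
      exact Set.image_congr fun i hi => by rw [normOrAugmentation, if_pos (Finset.mem_coe.1 hi)])).1
  rw [hE, Finset.card_erase_of_mem (Finset.mem_univ _), Finset.card_univ] at hquot
  have hsat : ∀ x, (ℓ : MonoidAlgebra ℤ Γ) * x ∈ 𝔞 → x ∈ 𝔞 :=
    saturated_span_sub_one_union_sElt hℓ.ne_zero hσE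
  set 𝔟 := 𝔞 ⊔ Ideal.span {sElt (Subgroup.zpowers (σ lst))} with h𝔟
  have hN𝔟 : ∀ ν ∈ powKer Γ c, MonoidAlgebra.of ℤ Γ ν - 1 ∈ 𝔞 := fun ν hν =>
    Ideal.subset_span (Or.inl ⟨ν, hν, rfl⟩)
  have hσ𝔟 : ∀ i, sElt (Subgroup.zpowers (σ i)) ∈ 𝔟 := fun i => by
    by_cases hi : i = lst
    · rw [hi]
      exact Ideal.mem_sup_right (Ideal.mem_span_singleton_self _)
    · exact Ideal.mem_sup_left (Ideal.subset_span (Or.inr ⟨i, by simp [hE, hi], rfl⟩))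
  have hfac := sElt_eq_mul_sElt_inf hac hexp hT
  have hzσ : ∀ i, sElt (powKer Γ c) * sElt (Subgroup.zpowers (σ i)) ∈ S := fun i => by
    obtain ⟨d, hd⟩ := Ideal.mem_span_singleton'.1
      (sElt_mem_span_sElt_of_le (inf_le_right : T i ⊓ powKer Γ c ≤ _))
    have h1 : sElt (powKer Γ c) * sElt (Subgroup.zpowers (σ i)) = d * sElt (T i) := by
      rw [← hd, hfac]
      ring
    rw [h1]
    exact Ideal.mul_mem_left _ _ (Ideal.subset_span ⟨i, rfl⟩)
  have hcard : ℓ.Coprime (Nat.card (powKer Γ c)) := coprime_card_of_le_powKer hℓ hℓc le_rfl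
  refine hquot.nonempty_torsion_equiv hcard (z := sElt (powKer Γ c))
    (mem_colon_sub_one_iff hjord hsat) ?_ ?_ ?_ ?_ ?_
  · rw [hS, Ideal.span_le]
    rintro _ ⟨i, rfl⟩
    simp only [SetLike.mem_coe, hfac i]
    exact Ideal.mul_mem_right _ _ (hσ𝔟 i)
  · have : 𝔟 ≤ S.colon {sElt (powKer Γ c)} := by
      refine sup_le (Ideal.span_le.2 (Set.union_subset ?_ ?_)) (Ideal.span_le.2 ?_)
      · rintro _ ⟨ν, hν, rfl⟩
        rw [SetLike.mem_coe, Submodule.mem_colon_singleton, smul_eq_mul, sub_one_mul_sElt _ hν]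
        exact zero_mem _
      · rintro _ ⟨i, -, rfl⟩
        rw [SetLike.mem_coe, Submodule.mem_colon_singleton, smul_eq_mul, mul_comm]
        exact hzσ i
      · rw [Set.singleton_subset_iff, SetLike.mem_coe, Submodule.mem_colon_singleton, smul_eq_mul,
          mul_comm]
        exact hzσ lst
    intro y hy
    have h1 := Submodule.mem_colon_singleton.1 (this hy)
    rwa [smul_eq_mul, mul_comm] at h1
  · exact fun y => sElt_mul_sub_card_mul_mem fun ν hν =>
      Ideal.mul_mem_right _ _ (Ideal.mem_sup_left (hN𝔟 ν hν))
  · intro k x hx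
    exact sElt_mul_sub_card_mul_mem fun ν hν => Submodule.mem_colon_singleton.1
      (powKer_le_trivialActing_colon hℓ hℓc hac hexp hTgen hT hσ hx hν)
  · refine exists_nsmul_eq_zmod ?_
    split_ifs
    · exact hcard.symm.pow_right r
    · exact Nat.coprime_one_right _

end TorsionOfNormQuotient

/-- Let `ℓ` be a prime, `m ≥ 2`, `r ≥ 0`, and `Γ` a finite abelian group generated by
subgroups `T_1, …, T_m` whose `ℓ`-Sylow subgroups are `S_i = T_i ⊓ (ℓ-primary part of Γ)`.
Suppose the `ℓ`-Sylow subgroup of `Γ` is the internal direct product `⟨τ_1⟩ × ⋯ × ⟨τ_m⟩`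
with `τ_i` of order `g_i` (`i < m`) and `τ_m` of order `g_m/ℓ^r`, where the `g_i` are
powers of `ℓ` with `ℓ^r ∣ g_m ≤ g_i`; suppose `S_i = ⟨τ_i⟩` for `i < m` and `S_m = ⟨j⟩`
where `j = τ_1^{g_1/g_m} ⋯ τ_{m-1}^{g_{m-1}/g_m} τ_m`.  Let `S̃` be the ideal of `ℤ[Γ]`
generated by `s(T_1), …, s(T_m)`.  Then the `ℓ`-primary component of the torsion
subgroup of `ℤ[Γ]/S̃` is trivial if `m` is even, and cyclic of order `ℓ^r` if `m` is
odd. -/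
theorem stmt_11 {Γ : Type} [CommGroup Γ] [Fintype Γ]
    (ℓ m r : ℕ) [hℓ : Fact ℓ.Prime] (hm : 2 ≤ m)
    (T : Fin m → Subgroup Γ) (hTgen : (⨆ i, T i) = ⊤)
    (τ : Fin m → Γ) (g : Fin m → ℕ)
    (lst : Fin m) (hlst : (lst : ℕ) = m - 1)
    (hpow : ∀ i, ∃ k, g i = ℓ ^ k)
    (hdvd : ℓ ^ r ∣ g lst)
    (hle : ∀ i, g lst ≤ g i)
    (hord : ∀ i, i ≠ lst → orderOf (τ i) = g i)
    (hordlst : orderOf (τ lst) = g lst / ℓ ^ r)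
    (hindep : iSupIndep fun i => Subgroup.zpowers (τ i))
    (hSylΓ : (⨆ i, Subgroup.zpowers (τ i)) = CommGroup.primaryComponent Γ ℓ)
    (j : Γ) (hj : j = ∏ i, τ i ^ (g i / g lst))
    (hSi : ∀ i, i ≠ lst → T i ⊓ CommGroup.primaryComponent Γ ℓ = Subgroup.zpowers (τ i))
    (hSlst : T lst ⊓ CommGroup.primaryComponent Γ ℓ = Subgroup.zpowers j)
    (Stilde : Ideal (MonoidAlgebra ℤ Γ))
    (hStilde : Stilde = Ideal.span (Set.range fun i => sElt (T i))) :
    (Even m → Subsingleton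
      (Submodule.torsion' ℤ (MonoidAlgebra ℤ Γ ⧸ Stilde) (Submonoid.powers (ℓ : ℤ)))) ∧
    (Odd m → Nonempty
      ((Submodule.torsion' ℤ (MonoidAlgebra ℤ Γ ⧸ Stilde) (Submonoid.powers (ℓ : ℤ)))
        ≃+ ZMod (ℓ ^ r))) := by
  obtain ⟨e, c, hℓc', hcard⟩ :=
    Nat.exists_eq_pow_mul_and_not_dvd (Nat.card_pos (α := Γ)).ne' ℓ hℓ.out.ne_one
  have hℓc : ℓ.Coprime c := hℓ.out.coprime_iff_not_dvd.2 hℓc'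
  have hac : (ℓ ^ e).Coprime c := hℓc.pow_left e
  have hexp : ∀ x : Γ, x ^ (ℓ ^ e * c) = 1 := fun x => by rw [← hcard, pow_card_eq_one']
  rw [primaryComponent_eq_powKer hℓc hexp] at hSylΓ hSlst
  simp only [primaryComponent_eq_powKer hℓc hexp] at hSi
  have hg : ∀ i, g i ≠ 0 := fun i => by
    obtain ⟨k, hk⟩ := hpow i
    rw [hk]
    exact pow_ne_zero k hℓ.out.ne_zero
  have hgdvd : ∀ i, g lst ∣ g i := fun i => by
    obtain ⟨k, hk⟩ := hpow i
    obtain ⟨n, hn⟩ := hpow lst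
    have := hle i
    rw [hk, hn] at this ⊢
    exact pow_dvd_pow ℓ ((Nat.pow_le_pow_iff_right hℓ.out.one_lt).1 this)
  have hτlst : orderOf (τ lst) ∣ g lst := hordlst ▸ Nat.div_dvd_of_dvd hdvd
  obtain ⟨i₀, hi₀⟩ : ∃ i₀ : Fin m, i₀ ≠ lst := by
    have : Nontrivial (Fin m) := Fin.nontrivial_iff_two_le.2 hm
    exact exists_ne lst
  have hjord : orderOf j = g lst :=
    Nat.dvd_antisymm
      (orderOf_dvd_of_pow_eq_one (diagonal_pow_eq_one hgdvd hord hτlst hj))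
      (dvd_of_diagonal_pow_mem hindep hg hgdvd hord hj hi₀ (by
        rw [pow_orderOf_eq_one]
        exact one_mem _))
  obtain ⟨n, hn⟩ := hpow lst
  have hsup : ⨆ i ∈ Finset.univ.erase lst, Subgroup.zpowers (Function.update τ lst j i) =
      ⨆ i ∈ Finset.univ.erase lst, Subgroup.zpowers (τ i) :=
    iSup_congr fun i => iSup_congr fun hi => by
      rw [Function.update_of_ne (Finset.ne_of_mem_erase hi)]
  have key := nonempty_torsion_equiv_zmod (σ := Function.update τ lst j) (lst := lst)
    (t := τ lst) (n := n) (r := r) hℓ.out hℓc hac hexp hTgen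
    (fun i => by
      by_cases hi : i = lst
      · rw [hi, Function.update_self, hSlst]
      · rw [Function.update_of_ne hi, hSi i hi])
    (fun _ _ hk => disjoint_update_diagonal hindep hg hgdvd hord hτlst hj hk)
    (by rw [Function.update_self, hjord, hn])
    (by
      rw [hsup]
      exact (hindep lst).mono_right (biSup_le_iSup_ne (Finset.notMem_erase _ _)))
    (by
      rw [hsup, ← hSylΓ, ← Finset.iSup_insert lst (Finset.univ.erase lst)
        fun i => Subgroup.zpowers (τ i), Finset.insert_erase (Finset.mem_univ _)]
      simp)
    (by
      rw [hsup, Function.update_self, hj, ← Finset.mul_prod_erase _ _ (Finset.mem_univ lst),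
        Nat.div_self (Nat.pos_of_ne_zero (hg lst)), pow_one, mul_inv_cancel_comm]
      exact prod_pow_mem_biSup _ _)
    (by rw [Function.update_self, hjord, hordlst, Nat.mul_div_cancel' hdvd])
  rw [← hStilde, Fintype.card_fin] at key
  refine ⟨fun hm' => ?_, fun hm' => ?_⟩
  · rw [if_neg (by rw [Nat.not_even_iff_odd]; exact Nat.Even.sub_odd (by lia) hm' odd_one)] at key
    obtain ⟨f⟩ := key
    have : Subsingleton (ZMod 1) := inferInstanceAs (Subsingleton (Fin 1))
    exact f.injective.subsingleton
  · rwa [if_pos (Nat.Odd.sub_odd hm' odd_one)] at key
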